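/- arXiv:2510.04642 — 2 statements merged into one kernel-verified Lean document; each statement's English description precedes it below -/
import Mathlib

section
/- Let g : [0,1] → [0,1] satisfy g(0)=0, g(1)=1, g(1−x)=1−g(x) for all x, and x ≤ x' iff g(x) ≤ g(x'). Given an eF-model M = ⟨W,(R_a),(T_a),v⟩, define the eF-model M̂ with the same states W and relations R_a, with T̂_a(w) = g[T_a(w)] (the image of T_a(w) under g), and with v̂(p,w)=g(v(p,w)) for every propositional variable p and state w. Then v̂(φ,w)=g(v(φ,w)) for every formula φ of the language L and every state w. -/
open scoped Classical

/-- Formulas of the language L over a set `A` of agents, with propositional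
variables indexed by `ℕ`. -/
inductive Formula (A : Type) : Type
  | var : ℕ → Formula A
  | neg : Formula A → Formula A
  | and : Formula A → Formula A → Formula A
  | imp : Formula A → Formula A → Formula A
  | box : A → Formula A → Formula A

namespace Formula

/-- `◇ₐφ := ~□ₐ~φ`. -/
def dia {A : Type} (a : A) (φ : Formula A) : Formula A := .neg (.box a (.neg φ))

/-- `φ ↔ χ := (φ→χ)∧(χ→φ)`. -/
def biImp {A : Type} (φ χ : Formula A) : Formula A := .and (.imp φ χ) (.imp χ φ)

/-- `𝟏 := p → p`. -/
def one {A : Type} : Formula A := .imp (.var 0) (.var 0)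

/-- Coimplication `φ ⤙ χ := ~(~χ → ~φ)`. -/
def coimp {A : Type} (φ χ : Formula A) : Formula A := .neg (.imp (.neg χ) (.neg φ))

/-- Baaz Delta `△φ := 𝟏 ⤙ (𝟏 ⤙ φ)`. -/
def tri {A : Type} (φ : Formula A) : Formula A := coimp one (coimp one φ)

/-- `φ^△`: replace every occurrence of every propositional variable `p` by `△p`. -/
def triSub {A : Type} : Formula A → Formula A
  | .var p => tri (.var p)
  | .neg φ => .neg φ.triSub
  | .and φ χ => .and φ.triSub χ.triSub
  | .imp φ χ => .imp φ.triSub χ.triSub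
  | .box a φ => .box a φ.triSub

/-- `ℓ(φ)`: the number of occurrences of symbols in `φ`. -/
def size {A : Type} : Formula A → ℕ
  | .var _ => 1
  | .neg φ => φ.size + 1
  | .and φ χ => φ.size + χ.size + 1
  | .imp φ χ => φ.size + χ.size + 1
  | .box _ φ => φ.size + 1

/-- On every branch of the syntactic tree, the first modal operator encountered
(if any) is not `□ₐ`. -/
def noUnguardedBox {A : Type} (a : A) : Formula A → Prop
  | .var _ => True
  | .neg φ => φ.noUnguardedBox a
  | .and φ χ => φ.noUnguardedBox a ∧ χ.noUnguardedBox a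
  | .imp φ χ => φ.noUnguardedBox a ∧ χ.noUnguardedBox a
  | .box b _ => b ≠ a

/-- A formula is irredundantly nested if in every branch of its syntactic tree,
between any two nodes `□ₐ` there occurs a node `□_{a'}` for some `a' ≠ a`. -/
def IrredundantlyNested {A : Type} : Formula A → Prop
  | .var _ => True
  | .neg φ => φ.IrredundantlyNested
  | .and φ χ => φ.IrredundantlyNested ∧ χ.IrredundantlyNested
  | .imp φ χ => φ.IrredundantlyNested ∧ χ.IrredundantlyNested
  | .box a φ => φ.noUnguardedBox a ∧ φ.IrredundantlyNested

/-- Auxiliary function for the modal alternation depth: the maximal alternation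
number over leaves, where `o` records the agent of the nearest modal ancestor. -/
def aDepth {A : Type} [DecidableEq A] : Formula A → Option A → ℕ
  | .var _, _ => 0
  | .neg φ, o => φ.aDepth o
  | .and φ χ, o => max (φ.aDepth o) (χ.aDepth o)
  | .imp φ χ, o => max (φ.aDepth o) (χ.aDepth o)
  | .box a φ, o => if o = some a then φ.aDepth (some a) else φ.aDepth (some a) + 1

/-- The modal alternation depth `𝒜(φ)`. -/
def altDepth {A : Type} [DecidableEq A] (φ : Formula A) : ℕ := φ.aDepth none

end Formula

/-- An S5G-model over agents `A` and states `W`: an epistemic frame (nonempty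
`W`, each `R a` an equivalence relation) with a `[0,1]`-valued valuation. -/
structure S5GModel (A W : Type) where
  nonempty : Nonempty W
  R : A → W → W → Prop
  equiv : ∀ a, Equivalence (R a)
  val : ℕ → W → ℝ
  val_mem : ∀ p w, val p w ∈ Set.Icc (0 : ℝ) 1

/-- Gödel semantics on S5G-models. -/
noncomputable def S5GModel.v {A W : Type} (M : S5GModel A W) : Formula A → W → ℝ
  | .var p, w => M.val p w
  | .neg φ, w => 1 - M.v φ w
  | .and φ χ, w => min (M.v φ w) (M.v χ w)
  | .imp φ χ, w => if M.v φ w ≤ M.v χ w then 1 else M.v χ w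
  | .box a φ, w => sInf {x : ℝ | ∃ w', M.R a w w' ∧ M.v φ w' = x}

/-- S5G-validity: value `1` at every state of every S5G-model. -/
def S5GValid (A : Type) (φ : Formula A) : Prop :=
  ∀ (W : Type) (M : S5GModel A W) (w : W), M.v φ w = 1

/-- S5G-satisfiability: value `1` at some state of some S5G-model. -/
def S5GSat (A : Type) (φ : Formula A) : Prop :=
  ∃ (W : Type) (M : S5GModel A W) (w : W), M.v φ w = 1

/-- An epistemic F-model (eF-model). -/
structure EFModel (A W : Type) where
  nonempty : Nonempty W
  R : A → W → W → Prop
  equiv : ∀ a, Equivalence (R a)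
  T : A → W → Set ℝ
  T_finite : ∀ a w, (T a w).Finite
  T_sub : ∀ a w, T a w ⊆ Set.Icc (0 : ℝ) 1
  T_zero : ∀ a w, (0 : ℝ) ∈ T a w
  T_half : ∀ a w, (1 / 2 : ℝ) ∈ T a w
  T_one : ∀ a w, (1 : ℝ) ∈ T a w
  T_inv : ∀ a w x, x ∈ T a w → 1 - x ∈ T a w
  T_R : ∀ a w w', R a w w' → T a w = T a w'
  val : ℕ → W → ℝ
  val_mem : ∀ p w, val p w ∈ Set.Icc (0 : ℝ) 1

/-- Semantics on eF-models: `v(□ₐφ,w)` is the greatest element of `T a w` below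
`inf{v(φ,w') : w Rₐ w'}` (rendered via `sSup` of the relevant finite set). -/
noncomputable def EFModel.v {A W : Type} (M : EFModel A W) : Formula A → W → ℝ
  | .var p, w => M.val p w
  | .neg φ, w => 1 - M.v φ w
  | .and φ χ, w => min (M.v φ w) (M.v χ w)
  | .imp φ χ, w => if M.v φ w ≤ M.v χ w then 1 else M.v χ w
  | .box a φ, w =>
      sSup {x : ℝ | x ∈ M.T a w ∧ x ≤ sInf {y : ℝ | ∃ w', M.R a w w' ∧ M.v φ w' = y}}

/-- eF-validity: value `1` at every state of every eF-model. -/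
def EFValid (A : Type) (φ : Formula A) : Prop :=
  ∀ (W : Type) (M : EFModel A W) (w : W), M.v φ w = 1

/-- Truth values of formulas in eF-models lie in the unit interval. -/
theorem EFModel.v_mem_Icc {A W : Type} (M : EFModel A W) (φ : Formula A) (w : W) :
    M.v φ w ∈ Set.Icc (0 : ℝ) 1 := by
  induction φ generalizing w with
  | var p => exact M.val_mem p w
  | neg φ ih =>
    have h := ih w
    simp only [EFModel.v, Set.mem_Icc] at h ⊢
    constructor <;> linarith
  | and φ χ ih₁ ih₂ =>
    exact ⟨le_min (ih₁ w).1 (ih₂ w).1, (min_le_left _ _).trans (ih₁ w).2⟩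
  | imp φ χ ih₁ ih₂ =>
    simp only [EFModel.v]
    split_ifs
    · exact ⟨zero_le_one, le_rfl⟩
    · exact ih₂ w
  | box a φ ih =>
    simp only [EFModel.v]
    exact ⟨Real.sSup_nonneg fun x hx => (M.T_sub a w hx.1).1,
      Real.sSup_le (fun x hx => (M.T_sub a w hx.1).2) zero_le_one⟩

/-- The value of `□ₐφ` at `w` is the greatest element of `T a w` that bounds from below
all values of `φ` at states accessible from `w`. -/
theorem EFModel.isGreatest_v_box {A W : Type} (M : EFModel A W) (a : A) (φ : Formula A)
    (w : W) :
    IsGreatest {x : ℝ | x ∈ M.T a w ∧ ∀ w', M.R a w w' → x ≤ M.v φ w'}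
      (M.v (.box a φ) w) := by
  have hset : {x : ℝ | x ∈ M.T a w ∧ ∀ w', M.R a w w' → x ≤ M.v φ w'} =
      {x : ℝ | x ∈ M.T a w ∧ x ≤ sInf {y : ℝ | ∃ w', M.R a w w' ∧ M.v φ w' = y}} := by
    ext x
    refine and_congr_right fun _ => ?_
    have hbdd : BddBelow {y : ℝ | ∃ w', M.R a w w' ∧ M.v φ w' = y} := by
      refine ⟨0, ?_⟩
      rintro _ ⟨w', -, rfl⟩
      exact (M.v_mem_Icc φ w').1
    rw [le_csInf_iff hbdd ⟨M.v φ w, w, (M.equiv a).refl w, rfl⟩]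
    constructor
    · rintro h _ ⟨w', hw', rfl⟩
      exact h w' hw'
    · exact fun h w' hw' => h _ ⟨w', hw', rfl⟩
  have hfin : {x : ℝ | x ∈ M.T a w ∧ ∀ w', M.R a w w' → x ≤ M.v φ w'}.Finite :=
    (M.T_finite a w).subset fun _ hx => hx.1
  have hne : {x : ℝ | x ∈ M.T a w ∧ ∀ w', M.R a w w' → x ≤ M.v φ w'}.Nonempty :=
    ⟨0, M.T_zero a w, fun w' _ => (M.v_mem_Icc φ w').1⟩
  have hv : M.v (.box a φ) w =
      sSup {x : ℝ | x ∈ M.T a w ∧ ∀ w', M.R a w w' → x ≤ M.v φ w'} := by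
    rw [hset, EFModel.v]
  rw [hv]
  exact ⟨hne.csSup_mem hfin, fun _ hx => le_csSup hfin.bddAbove hx⟩

/-- transferring an eF-model along an order automorphism `g` of
`[0,1]` commuting with `x ↦ 1 - x` rescales all truth values by `g`. -/
theorem stmt3 (A W : Type) [Fintype A] [Nonempty A] (M M' : EFModel A W) (g : ℝ → ℝ)
    (hg01 : ∀ x ∈ Set.Icc (0 : ℝ) 1, g x ∈ Set.Icc (0 : ℝ) 1)
    (hg0 : g 0 = 0) (hg1 : g 1 = 1)
    (hginv : ∀ x ∈ Set.Icc (0 : ℝ) 1, g (1 - x) = 1 - g x)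
    (hgmono : ∀ x ∈ Set.Icc (0 : ℝ) 1, ∀ x' ∈ Set.Icc (0 : ℝ) 1, (x ≤ x' ↔ g x ≤ g x'))
    (hR : M'.R = M.R)
    (hT : ∀ a w, M'.T a w = g '' M.T a w)
    (hval : ∀ p w, M'.val p w = g (M.val p w)) :
    ∀ (φ : Formula A) (w : W), M'.v φ w = g (M.v φ w) := by
  intro φ
  induction φ with
  | var p => exact fun w => hval p w
  | neg φ ih =>
    intro w
    rw [EFModel.v, EFModel.v, ih w, hginv _ (M.v_mem_Icc φ w)]
  | and φ χ ih₁ ih₂ =>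
    intro w
    have hmono : MonotoneOn g (Set.Icc (0 : ℝ) 1) :=
      fun x hx y hy hxy => (hgmono x hx y hy).1 hxy
    rw [EFModel.v, EFModel.v, ih₁ w, ih₂ w,
      hmono.map_min (M.v_mem_Icc φ w) (M.v_mem_Icc χ w)]
  | imp φ χ ih₁ ih₂ =>
    intro w
    have h := hgmono _ (M.v_mem_Icc φ w) _ (M.v_mem_Icc χ w)
    simp only [EFModel.v, ih₁ w, ih₂ w, ← h]
    split_ifs
    · exact hg1.symm
    · rfl
  | box a φ ih =>
    intro w
    refine (M'.isGreatest_v_box a φ w).unique ?_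
    obtain ⟨⟨hmem, hle⟩, hub⟩ := M.isGreatest_v_box a φ w
    have hbox := M.v_mem_Icc (.box a φ) w
    refine ⟨⟨?_, fun w' hw' => ?_⟩, ?_⟩
    · rw [hT]
      exact ⟨_, hmem, rfl⟩
    · rw [hR] at hw'
      rw [ih w']
      exact (hgmono _ hbox _ (M.v_mem_Icc φ w')).1 (hle w' hw')
    · rintro y ⟨hy, hyle⟩
      rw [hT] at hy
      obtain ⟨x, hx, rfl⟩ := hy
      have hxI := M.T_sub a w hx
      refine (hgmono _ hxI _ hbox).1 (hub ⟨hx, fun w' hw' => ?_⟩)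
      refine (hgmono _ hxI _ (M.v_mem_Icc φ w')).2 ?_
      rw [← ih w']
      exact hyle w' (by rwa [hR])
end

section
/- Let M = ⟨W,(R_a)_{a∈A},(T_a)_{a∈A},v⟩ be an eF-model. Define a classical S5 Kripke model M^cl = ⟨W,(R_a),v^cl⟩ with v^cl(p,w)=1 if v(p,w)=1 and v^cl(p,w)=0 otherwise, extended by the classical semantics. For a formula φ of L, let φ^△ be the result of replacing every occurrence of every propositional variable p in φ with △p. Then v(φ^△,w) = v^cl(φ,w) for every formula φ of L and every state w (identifying the classical values 0,1 with the reals 0,1). -/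
open scoped Classical

/-- A classical S5 Kripke model: an epistemic frame with a two-valued valuation. -/
structure ClassicalModel (A W : Type) where
  nonempty : Nonempty W
  R : A → W → W → Prop
  equiv : ∀ a, Equivalence (R a)
  val : ℕ → W → Bool

/-- Classical Kripke semantics (truth at a state). -/
def ClassicalModel.v {A W : Type} (M : ClassicalModel A W) : Formula A → W → Prop
  | .var p, w => M.val p w = true
  | .neg φ, w => ¬ M.v φ w
  | .and φ χ, w => M.v φ w ∧ M.v χ w
  | .imp φ χ, w => M.v φ w → M.v χ w
  | .box a φ, w => ∀ w', M.R a w w' → M.v φ w'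

theorem EFModel.v_one {A W : Type} (M : EFModel A W) (w : W) : M.v .one w = 1 := by
  simp [Formula.one, EFModel.v]

theorem EFModel.v_one_coimp {A W : Type} (M : EFModel A W) (φ : Formula A) (w : W) :
    M.v (.coimp .one φ) w = if 1 ≤ M.v φ w then 0 else 1 := by
  have h : 1 - M.v φ w ≤ 0 ↔ 1 ≤ M.v φ w := sub_nonpos
  simp only [Formula.coimp, EFModel.v, v_one, sub_self, h]
  split_ifs <;> norm_num

theorem EFModel.v_tri {A W : Type} (M : EFModel A W) (φ : Formula A) (w : W) :
    M.v φ.tri w = if 1 ≤ M.v φ w then 1 else 0 := by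
  rw [Formula.tri, v_one_coimp, v_one_coimp]
  split_ifs <;> simp_all <;> linarith

/-- If `φ` is two-valued, with truth set `P`, on the `a`-class of `w`, then so is `□ₐφ` at `w`. -/
theorem EFModel.v_box_of_two_valued {A W : Type} (M : EFModel A W) (a : A) (φ : Formula A)
    (w : W) (P : W → Prop) (h : ∀ w', M.R a w w' → M.v φ w' = if P w' then 1 else 0) :
    M.v (.box a φ) w = if ∀ w', M.R a w w' → P w' then 1 else 0 := by
  have hinf : sInf {y : ℝ | ∃ w', M.R a w w' ∧ M.v φ w' = y} =
      if ∀ w', M.R a w w' → P w' then 1 else 0 := by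
    split_ifs with hP
    · refine IsLeast.csInf_eq ⟨⟨w, (M.equiv a).refl w, ?_⟩, ?_⟩
      · rw [h w ((M.equiv a).refl w), if_pos (hP w ((M.equiv a).refl w))]
      · rintro y ⟨w', hw', rfl⟩
        rw [h w' hw', if_pos (hP w' hw')]
    · push Not at hP
      obtain ⟨w', hw', hn⟩ := hP
      refine IsLeast.csInf_eq ⟨⟨w', hw', by rw [h w' hw', if_neg hn]⟩, ?_⟩
      rintro y ⟨w'', hw'', rfl⟩
      rw [h w'' hw'']
      split_ifs <;> norm_num
  rw [EFModel.v, hinf]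
  refine IsGreatest.csSup_eq ⟨⟨?_, le_rfl⟩, fun x hx => hx.2⟩
  split_ifs
  exacts [M.T_one a w, M.T_zero a w]

/-- from an eF-model `M` to the classical S5 model `M^cl` (true at
`w` iff value `1`): `v(φ^△,w) = v^cl(φ,w)`. -/
theorem stmt12 (A W : Type) [Fintype A] [Nonempty A]
    (M : EFModel A W) (M' : ClassicalModel A W)
    (hR : M'.R = M.R)
    (hval : ∀ p w, (M'.val p w = true) ↔ M.val p w = 1) :
    ∀ (φ : Formula A) (w : W), M.v φ.triSub w = if M'.v φ w then (1 : ℝ) else 0 := by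
  intro φ
  induction φ with
  | var p =>
    intro w
    have h : 1 ≤ M.val p w ↔ M.val p w = 1 :=
      ⟨fun h => le_antisymm (M.val_mem p w).2 h, fun h => h.ge⟩
    simp only [Formula.triSub, EFModel.v_tri, EFModel.v, ClassicalModel.v, hval, h]
  | neg φ ih =>
    intro w
    simp only [Formula.triSub, EFModel.v, ClassicalModel.v, ih]
    split_ifs <;> simp_all
  | and φ χ ihφ ihχ =>
    intro w
    simp only [Formula.triSub, EFModel.v, ClassicalModel.v, ihφ, ihχ]
    by_cases h₁ : M'.v φ w <;> by_cases h₂ : M'.v χ w <;> simp [h₁, h₂]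
  | imp φ χ ihφ ihχ =>
    intro w
    simp only [Formula.triSub, EFModel.v, ClassicalModel.v, ihφ, ihχ]
    by_cases h₁ : M'.v φ w <;> by_cases h₂ : M'.v χ w <;> simp [h₁, h₂]
  | box a φ ih =>
    intro w
    simp only [Formula.triSub, ClassicalModel.v, hR]
    exact M.v_box_of_two_valued a _ w (M'.v φ) fun w' _ => ih w'
end
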